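/- Let n ≥ 2 be an integer, α > 0, p ∈ {1,…,n−1} coprime to n, and let g be a type (i) coupling satisfying the quantisation condition M ∈ ℤ ∖ {0}. Then for every μ ∈ Λ⁺_{p,|M|}, all sine denominators occurring in Δ_p(μ) are nonzero and Δ_p(μ) > 0. -/

import Mathlib

noncomputable section
open Real Finset
open scoped Classical

/-- The standard basis vector `e_j` of `ℝⁿ` (1-based index), extended `n`-periodically
(`e_{n+j} = e_j`). -/
def ee (n j : ℕ) : Fin n → ℝ := fun i => if ((i : ℕ) + 1) % n = j % n then 1 else 0

/-- The standard inner product on `ℝⁿ`. -/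
def inn {n : ℕ} (x y : Fin n → ℝ) : ℝ := ∑ i, x i * y i

/-- The coordinate `x_j` (1-based index) with the convention `x_{n+k} = x_k - 2π/α`. -/
def coord {n : ℕ} (α : ℝ) (x : Fin n → ℝ) (j : ℕ) : ℝ :=
  if h : 0 < n then x ⟨(j - 1) % n, Nat.mod_lt _ h⟩ - 2 * π / α * (((j - 1) / n : ℕ) : ℝ)
  else 0

/-- The simple roots `a_{j,p} = e_j - e_{j+p}`. -/
def aa (n p j : ℕ) : Fin n → ℝ := ee n j - ee n (j + p)

/-- The closed simplex `Σ̄_{g,p} = {x ∈ E_n : sgn(M)(x_j - x_{j+p} - g) ≥ 0, j = 1,…,n}`,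
where `M = 2πp/α - ng`. -/
def SigmaBar (n p : ℕ) (α g : ℝ) : Set (Fin n → ℝ) :=
  {x | (∑ i, x i) = 0 ∧ ∀ j ∈ Icc 1 n,
    0 ≤ Real.sign (2 * π * p / α - n * g) * (coord α x j - coord α x (j + p) - g)}

/-- The interior `Σ_{g,p}` of the simplex, cut out by the strict inequalities. -/
def SigmaInt (n p : ℕ) (α g : ℝ) : Set (Fin n → ℝ) :=
  {x | (∑ i, x i) = 0 ∧ ∀ j ∈ Icc 1 n,
    0 < Real.sign (2 * π * p / α - n * g) * (coord α x j - coord α x (j + p) - g)}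

/-- `g` is a type (i) coupling, with `q ∈ {1,…,n-1}` the multiplicative inverse of `p` mod `n`. -/
def TypeI (n p q : ℕ) (α g : ℝ) : Prop :=
  1 ≤ q ∧ q ≤ n - 1 ∧ (p * q) % n = 1 % n ∧
  ((2 * π / α * ((p : ℝ) / n - 1 / ((n : ℝ) * q)) < g ∧ g < 2 * π / α * ((p : ℝ) / n)) ∨
   (2 * π / α * ((p : ℝ) / n) < g ∧
      g < 2 * π / α * ((p : ℝ) / n + 1 / ((n : ℝ) * ((n : ℝ) - q)))))

/-- `ρ_p = g(ω_{1,p}+…+ω_{n-p,p}) + (g - 2π/α)(ω_{n-p+1,p}+…+ω_{n-1,p})`. -/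
def rhoP (n p : ℕ) (α g : ℝ) (ω : ℕ → Fin n → ℝ) : Fin n → ℝ :=
  g • (∑ j ∈ Icc 1 (n - p), ω j) + (g - 2 * π / α) • (∑ j ∈ Icc (n - p + 1) (n - 1), ω j)

/-- `Λ⁺_{p,|M|}`: nonnegative integral combinations of the `ω_{j,p}` with coefficient sum `≤ |M|`. -/
def Lam (n : ℕ) (Mabs : ℝ) (ω : ℕ → Fin n → ℝ) : Set (Fin n → ℝ) :=
  {μ | ∃ m : ℕ → ℕ, (∑ j ∈ Icc 1 (n - 1), (m j : ℝ)) ≤ Mabs ∧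
    μ = ∑ j ∈ Icc 1 (n - 1), (m j : ℝ) • ω j}

/-- The fundamental weight `ω_r = e_1+…+e_r - (r/n)(e_1+…+e_n)`. -/
def omegaStd (n r : ℕ) : Fin n → ℝ :=
  fun i => (if (i : ℕ) + 1 ≤ r then 1 else 0) - (r : ℝ) / n

/-- Membership in the orbit `S_n(ω_r)` of `ω_r` under coordinate permutations. -/
def inOrbit (n r : ℕ) (ν : Fin n → ℝ) : Prop :=
  ∃ σ : Equiv.Perm (Fin n), ν = fun i => omegaStd n r (σ i)

/-- The orbit `S_n(ω_r)` as a finite set. -/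
def orbitF (n r : ℕ) : Finset (Fin n → ℝ) :=
  Finset.image (fun σ : Equiv.Perm (Fin n) => fun i => omegaStd n r (σ i)) Finset.univ

/-- `V_ν(g;x) = ∏_{a ∈ A_{n-1}, ⟨a,ν⟩=1} sin(α(⟨a,x⟩+g)/2)/sin(α⟨a,x⟩/2)`. -/
def Vnu (n : ℕ) (α g : ℝ) (ν x : Fin n → ℝ) : ℝ :=
  ∏ j ∈ Icc 1 n, ∏ k ∈ Icc 1 n,
    if j ≠ k ∧ inn (ee n j - ee n k) ν = 1 then
      Real.sin (α * (inn (ee n j - ee n k) x + g) / 2) /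
        Real.sin (α * inn (ee n j - ee n k) x / 2)
    else 1

/-- `V_J(g;x) = ∏_{j∈J, k∉J} sin(α(x_j-x_k+g)/2)/sin(α(x_j-x_k)/2)`. -/
def VJ (n : ℕ) (α g : ℝ) (J : Finset ℕ) (x : Fin n → ℝ) : ℝ :=
  ∏ j ∈ J, ∏ k ∈ Icc 1 n \ J,
    Real.sin (α * (coord α x j - coord α x k + g) / 2) /
      Real.sin (α * (coord α x j - coord α x k) / 2)

/-- `F_J(g;x) = ∏_{j,k∈J, j≠k} sin(α(x_j-x_k)/2)/sin(α(x_j-x_k+g)/2)`. -/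
def FJ (n : ℕ) (α g : ℝ) (J : Finset ℕ) (x : Fin n → ℝ) : ℝ :=
  ∏ j ∈ J, ∏ k ∈ J,
    if j ≠ k then
      Real.sin (α * (coord α x j - coord α x k) / 2) /
        Real.sin (α * (coord α x j - coord α x k + g) / 2)
    else 1

/-- The trigonometric Pochhammer symbol `(z : sin_α)_m`. -/
def poch (α z : ℝ) (m : ℤ) : ℝ :=
  if 0 ≤ m then ∏ l ∈ Finset.range m.toNat, Real.sin (α * (z + l) / 2)
  else 1 / ∏ l ∈ Finset.Icc 1 (-m).toNat, Real.sin (α * (z - l) / 2)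

/-- Membership in the set of positive roots `A⁺_{n-1,p}`. -/
def inPosRoots (n p : ℕ) (v : Fin n → ℝ) : Prop :=
  (∃ j ∈ Icc 1 n, ∃ k ∈ Icc 1 n, j ≠ k ∧ v = ee n j - ee n k) ∧
  ∃ c : ℕ → ℕ, v = ∑ j ∈ Icc 1 (n - 1), (c j : ℝ) • aa n p j

/-- The lattice function `Δ_p(μ)`. -/
def Delta (n p : ℕ) (α g : ℝ) (ω : ℕ → Fin n → ℝ) (μ : Fin n → ℝ) : ℝ :=
  ∏ j ∈ Icc 1 n, ∏ k ∈ Icc 1 n,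
    if inPosRoots n p (ee n j - ee n k) then
      Real.sin (α * inn (ee n j - ee n k)
          (rhoP n p α g ω + Real.sign (2 * π * p / α - n * g) • μ) / 2) /
        Real.sin (α * inn (ee n j - ee n k) (rhoP n p α g ω) / 2) *
      (poch α (inn (ee n j - ee n k) (rhoP n p α g ω) +
            Real.sign (2 * π * p / α - n * g) * g)
          ⌊Real.sign (2 * π * p / α - n * g) * inn (ee n j - ee n k) μ⌋ /
        poch α (inn (ee n j - ee n k) (rhoP n p α g ω) + 1 -
            Real.sign (2 * π * p / α - n * g) * g)
          ⌊Real.sign (2 * π * p / α - n * g) * inn (ee n j - ee n k) μ⌋)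
    else 1

/-- The coefficient `W_ν(ρ_p + sgn(M)μ)` (equal to `0` when `μ + ν ∉ Λ⁺_{p,|M|}`). -/
def Wmu (n p : ℕ) (α g : ℝ) (ω : ℕ → Fin n → ℝ) (s : (Fin n → ℝ) → ℝ)
    (μ ν : Fin n → ℝ) : ℝ :=
  if μ + ν ∈ Lam n |2 * π * p / α - n * g| ω then
    s ν * Real.sqrt
      (Vnu n α g ν (rhoP n p α g ω + Real.sign (2 * π * p / α - n * g) • μ) *
       Vnu n α g ν (-(rhoP n p α g ω) - Real.sign (2 * π * p / α - n * g) • (μ + ν)))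
  else 0

/-- The discrete difference operator `Ŝ_{r,M}` acting on lattice functions. -/
def SOp (n p r : ℕ) (α g : ℝ) (ω : ℕ → Fin n → ℝ) (s : (Fin n → ℝ) → ℝ)
    (φ : (Fin n → ℝ) → ℂ) : (Fin n → ℝ) → ℂ :=
  fun x => ∑ ν ∈ orbitF n r,
    (Wmu n p α g ω s (Real.sign (2 * π * p / α - n * g) • (x - rhoP n p α g ω)) ν : ℂ) *
      φ (x + Real.sign (2 * π * p / α - n * g) • ν)

/-- The inner product `(φ, ψ)_{p,M}` on lattice functions. -/
def ip (n p : ℕ) (α g : ℝ) (ω : ℕ → Fin n → ℝ) (φ ψ : (Fin n → ℝ) → ℂ) : ℂ :=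
  ∑ᶠ μ ∈ Lam n |2 * π * p / α - n * g| ω,
    φ (rhoP n p α g ω + Real.sign (2 * π * p / α - n * g) • μ) *
      starRingEnd ℂ (ψ (rhoP n p α g ω + Real.sign (2 * π * p / α - n * g) • μ))

/-- The elementary symmetric function `ℰ_r(u) = Σ_{ν ∈ S_n(ω_r)} exp(iα⟨ν,u⟩)`. -/
def calE (n r : ℕ) (α : ℝ) (u : Fin n → ℝ) : ℂ :=
  ∑ ν ∈ orbitF n r, Complex.exp (Complex.I * (α : ℂ) * (inn ν u : ℂ))

/-- `sin` has sign `(-1)^k` on the open interval `(kπ, (k+1)π)`, in rescaled form. -/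
lemma neg_one_zpow_mul_sin_pos {α x : ℝ} (hα : 0 < α) (k : ℤ)
    (h1 : 2 * π / α * k < x) (h2 : x < 2 * π / α * (k + 1)) :
    0 < (-1 : ℝ) ^ k * Real.sin (α * x / 2) := by
  rw [← Real.sin_sub_int_mul_pi]
  have e1 : α * (2 * π / α * k) / 2 = k * π := by field_simp
  have e2 : α * (2 * π / α * (k + 1)) / 2 = k * π + π := by field_simp
  have h1' := mul_lt_mul_of_pos_left h1 hα
  have h2' := mul_lt_mul_of_pos_left h2 hα
  apply Real.sin_pos_of_pos_of_lt_pi <;> linarith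

/-- If `d ≡ L p` and `p q ≡ 1` modulo `n`, then `L ≤ q (d mod n)` and `n - L ≤ q (n - d mod n)`. -/
lemma le_inverse_mul_emod {n p q L d : ℤ} (hq : 0 ≤ q) (hpq : n ∣ p * q - 1)
    (hL1 : 1 ≤ L) (hLn : L < n) (hd : n ∣ d - L * p) :
    L ≤ q * (d % n) ∧ n - L ≤ q * (n - d % n) := by
  obtain ⟨a, ha⟩ := hpq
  obtain ⟨b, hb⟩ := hd
  have he := Int.emod_add_mul_ediv d n
  have key : q * (d % n) - L = n * (q * b + L * a - q * (d / n)) := by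
    linear_combination q * he + q * hb + L * ha
  have k2 : q * (n - d % n) - (n - L) = n * (q - 1 - (q * b + L * a - q * (d / n))) := by
    linear_combination -key
  have aux : ∀ x : ℤ, -n < n * x → 0 ≤ n * x := by
    intro x hx
    have hx0 : 0 ≤ x := by
      by_contra! h
      nlinarith
    nlinarith
  have h0 := Int.emod_nonneg d (show n ≠ 0 by omega)
  have h1 := Int.emod_lt_of_pos d (show 0 < n by omega)
  have h2 : 0 ≤ q * (d % n) := by positivity
  have h3 : 0 ≤ q * (n - d % n) := mul_nonneg hq (by omega)
  constructor
  · have := aux _ (show -n < n * (q * b + L * a - q * (d / n)) by omega)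
    omega
  · have := aux _ (show -n < n * (q - 1 - (q * b + L * a - q * (d / n))) by omega)
    omega

/-- The values `(R d - L M) / n + x` with `0 ≤ x ≤ M` stay between consecutive multiples of
`R = 2π/α`. -/
lemma root_value_bounds {n p q L d : ℤ} {R M x : ℝ} (hq : 0 ≤ q)
    (hpq : n ∣ p * q - 1) (hM : 0 < M) (hqM : q * M < R) (hL1 : 1 ≤ L) (hLn : L < n)
    (hd : n ∣ d - L * p) (hx0 : 0 ≤ x) (hxM : x ≤ M) :
    R * ((d / n : ℤ) : ℝ) < (R * d - L * M) / n + x ∧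
      (R * d - L * M) / n + x < R * (((d / n : ℤ) : ℝ) + 1) := by
  obtain ⟨h1, h2⟩ := le_inverse_mul_emod hq hpq hL1 hLn hd
  have hn : 0 < n := by omega
  have he : (d : ℝ) = ((d % n : ℤ) : ℝ) + n * ((d / n : ℤ) : ℝ) := by
    exact_mod_cast (Int.emod_add_mul_ediv d n).symm
  set e := d % n with hedef
  set k := d / n
  have hlt : e < n := Int.emod_lt_of_pos d hn
  have hpos : 0 < e := by
    have := Int.emod_nonneg d hn.ne'
    by_contra! h
    have : e = 0 := le_antisymm h this
    rw [this] at h1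
    omega
  have hnR : (0 : ℝ) < n := by exact_mod_cast hn
  have hposR : (0 : ℝ) < e := by exact_mod_cast hpos
  have hltR : (0 : ℝ) < n - e := by exact_mod_cast sub_pos.2 hlt
  have h1R : (L : ℝ) ≤ q * e := by exact_mod_cast h1
  have h2R : (n : ℝ) - L ≤ q * (n - e) := by exact_mod_cast h2
  have i1 : L * M < R * e := by nlinarith
  have i2 : (n - L) * M < R * (n - e) := by nlinarith
  have ex : (R * d - L * M) / n = R * k + (R * e - L * M) / n := by
    rw [he]; field_simp; ring
  rw [ex]
  have i3 : 0 < (R * e - L * M) / n := div_pos (by linarith) hnR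
  have i4 : (R * e - L * M) / n < R - M := by
    rw [div_lt_iff₀ hnR]; linarith
  constructor <;> linarith

/-- The exponent of the sign attached to roots of height `L`. -/
def signExp (n p L : ℤ) : ℤ := (L * p % n - p) / n

lemma floor_add_floor_eq_signExp {n p q L d : ℤ} (hp1 : 1 ≤ p) (hpn : p < n) (hq : 0 ≤ q)
    (hpq : n ∣ p * q - 1) (hL1 : 1 ≤ L) (hLn : L < n) (hd : n ∣ d - L * p) :
    (d + p - 1) / n + (d - p) / n = 2 * (d / n) + signExp n p L - signExp n p (n - L) := by
  obtain ⟨h1, -⟩ := le_inverse_mul_emod hq hpq hL1 hLn hd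
  have hn : 0 < n := by omega
  have hlt := Int.emod_lt_of_pos d hn
  have hnn := Int.emod_nonneg d hn.ne'
  have hne : d % n ≠ 0 := by
    intro h
    rw [h] at h1
    omega
  have he := Int.emod_add_mul_ediv d n
  have m1 : L * p % n = d % n :=
    ((Int.emod_emod_of_dvd d (dvd_refl n)).symm.trans (by
      rw [Int.emod_emod_of_dvd d (dvd_refl n)]
      exact Int.emod_eq_emod_iff_emod_sub_eq_zero.2 (Int.emod_eq_zero_of_dvd hd))).symm
  have m2 : (n - L) * p % n = n - d % n := by
    have : (n - L) * p = (n - d % n) + n * (p - 1 - (L * p) / n) := by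
      have := Int.emod_add_mul_ediv (L * p) n
      rw [m1] at this
      linear_combination this
    rw [this, Int.add_mul_emod_self_left]
    exact Int.emod_eq_of_lt (by omega) (by omega)
  unfold signExp
  rw [m1, m2]
  set e := d % n
  set k := d / n
  have a1 : (d + p - 1) / n = (e + p - 1) / n + k := by
    rw [← he, show e + n * k + p - 1 = (e + p - 1) + n * k by ring,
      Int.add_mul_ediv_left _ _ hn.ne']
  have a2 : (d - p) / n = (e - p) / n + k := by
    rw [← he, show e + n * k - p = (e - p) + n * k by ring,
      Int.add_mul_ediv_left _ _ hn.ne']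
  have a3 : (e + p - 1) / n = - ((n - e - p) / n) := by
    rcases le_or_gt (e + p) n with h | h
    · rw [Int.ediv_eq_zero_of_lt (by omega) (by omega),
        Int.ediv_eq_zero_of_lt (by omega) (by omega), neg_zero]
    · rw [(Int.ediv_emod_unique hn (r := e + p - 1 - n) (q := 1)).2 ⟨by ring, by omega, by omega⟩ |>.1,
        (Int.ediv_emod_unique hn (r := n - e - p + n) (q := -1)).2 ⟨by ring, by omega, by omega⟩ |>.1]
      norm_num
  omega

lemma sign_upper_pochhammer {n p q L d : ℤ} {α g M x : ℝ} (hα : 0 < α)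
    (hq : 0 < q) (hpq : n ∣ p * q - 1) (hM : 0 < M)
    (hqM : q * M < 2 * π / α) (hg : n * g = 2 * π / α * p - M) (hL1 : 1 ≤ L) (hLn : L < n)
    (hd : n ∣ d - L * p) (hx0 : 0 ≤ x) (hxM : x + 1 ≤ M) :
    0 < (-1 : ℝ) ^ ((d + p - 1) / n) *
      Real.sin (α * ((2 * π / α * d - L * M) / n + g + x) / 2) := by
  have hn : 0 < n := by omega
  have hnR : (0 : ℝ) < n := by exact_mod_cast hn
  have hR : M < 2 * π / α := by
    have : (1 : ℝ) ≤ q := by exact_mod_cast hq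
    nlinarith
  have hg' : g = (2 * π / α * p - M) / n := by
    rw [← hg]; field_simp
  have ez : (2 * π / α * d - L * M) / n + g =
      (2 * π / α * ((d + p : ℤ) : ℝ) - ((L + 1 : ℤ) : ℝ) * M) / n := by
    rw [hg']; push_cast; ring
  have hd' : n ∣ (d + p) - (L + 1) * p := by
    convert hd using 1; ring
  rw [ez]
  rcases lt_or_eq_of_le (show L + 1 ≤ n by omega) with h | h
  · obtain ⟨b1, b2⟩ := root_value_bounds hq.le hpq hM hqM (by omega) h hd' hx0
      (by linarith)
    have h1 := (le_inverse_mul_emod hq.le hpq (by omega) h hd').1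
    have hne : (d + p) % n ≠ 0 := by
      intro h0
      rw [h0] at h1
      omega
    have hnn := Int.emod_nonneg (d + p) hn.ne'
    have hlt := Int.emod_lt_of_pos (d + p) hn
    have hk : (d + p - 1) / n = (d + p) / n :=
      ((Int.ediv_emod_unique hn (r := (d + p) % n - 1)).2
        ⟨by linear_combination Int.emod_add_mul_ediv (d + p) n, by omega, by omega⟩).1
    rw [hk]
    exact neg_one_zpow_mul_sin_pos hα _ b1 b2
  · obtain ⟨c, hc⟩ : n ∣ d + p := by
      rw [h] at hd'
      simpa using dvd_add hd' (dvd_mul_right n p)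
    have hk : (d + p - 1) / n = c - 1 :=
      ((Int.ediv_emod_unique hn (r := n - 1)).2
        ⟨by linear_combination -hc, by omega, by omega⟩).1
    rw [hk]
    have e2 : (2 * π / α * ((d + p : ℤ) : ℝ) - ((L + 1 : ℤ) : ℝ) * M) / n =
        2 * π / α * c - M := by
      rw [h, hc]; push_cast; field_simp
    rw [e2]
    apply neg_one_zpow_mul_sin_pos hα <;> push_cast <;> linarith

lemma sign_lower_pochhammer {n p q L d : ℤ} {α g M x : ℝ} (hα : 0 < α)
    (hq : 0 < q) (hpq : n ∣ p * q - 1) (hM : 0 < M)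
    (hqM : q * M < 2 * π / α) (hg : n * g = 2 * π / α * p - M) (hL1 : 1 ≤ L) (hLn : L < n)
    (hd : n ∣ d - L * p) (hx0 : 0 ≤ x) (hxM : x + 1 ≤ M) :
    0 < (-1 : ℝ) ^ ((d - p) / n) *
      Real.sin (α * ((2 * π / α * d - L * M) / n + 1 - g + x) / 2) := by
  have hn : 0 < n := by omega
  have hnR : (0 : ℝ) < n := by exact_mod_cast hn
  have hR : M < 2 * π / α := by
    have : (1 : ℝ) ≤ q := by exact_mod_cast hq
    nlinarith
  have hg' : g = (2 * π / α * p - M) / n := by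
    rw [← hg]; field_simp
  have ez : (2 * π / α * d - L * M) / n + 1 - g + x =
      (2 * π / α * ((d - p : ℤ) : ℝ) - ((L - 1 : ℤ) : ℝ) * M) / n + (x + 1) := by
    rw [hg']; push_cast; ring
  have hd' : n ∣ (d - p) - (L - 1) * p := by
    convert hd using 1; ring
  rw [ez]
  rcases lt_or_eq_of_le hL1 with h | h
  · obtain ⟨b1, b2⟩ := root_value_bounds hq.le hpq hM hqM (by omega) (by omega) hd'
      (by linarith) hxM
    exact neg_one_zpow_mul_sin_pos hα _ b1 b2
  · rw [← h] at hd' ⊢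
    obtain ⟨c, hc⟩ : n ∣ d - p := by simpa using hd'
    rw [hc, Int.mul_ediv_cancel_left _ hn.ne']
    have e2 : (2 * π / α * ((n * c : ℤ) : ℝ) - (((1 : ℤ) - 1 : ℤ) : ℝ) * M) / n =
        2 * π / α * c := by
      push_cast; field_simp; ring
    rw [e2]
    apply neg_one_zpow_mul_sin_pos hα <;> linarith

lemma neg_one_zpow_mul_neg_one_zpow (k : ℤ) : (-1 : ℝ) ^ k * (-1) ^ k = 1 := by
  rw [← mul_zpow]; simp

lemma prod_ne_zero_and_sign {c : ℝ} {f : ℕ → ℝ} {N : ℕ} (h : ∀ l < N, 0 < c * f l) :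
    (∏ l ∈ range N, f l) ≠ 0 ∧ 0 < c ^ N * ∏ l ∈ range N, f l := by
  have h0 : 0 < ∏ l ∈ range N, c * f l := prod_pos fun l hl => h l (mem_range.1 hl)
  rw [prod_mul_distrib, prod_const, card_range] at h0
  exact ⟨fun h' => by simp [h'] at h0, h0⟩

/-- The weight contributed by one positive root of height `L`, for a positive number `M`. -/
lemma root_factor_sign {n p q L d : ℤ} {α g M : ℝ} {N : ℕ} (hα : 0 < α)
    (hp1 : 1 ≤ p) (hpn : p < n) (hq : 0 < q) (hpq : n ∣ p * q - 1) (hM : 0 < M)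
    (hqM : q * M < 2 * π / α) (hg : n * g = 2 * π / α * p - M) (hL1 : 1 ≤ L) (hLn : L < n)
    (hd : n ∣ d - L * p) (hN : (N : ℝ) ≤ M) {z : ℝ} (hz : z = (2 * π / α * d - L * M) / n) :
    Real.sin (α * z / 2) ≠ 0 ∧
    (∏ l ∈ range N, Real.sin (α * (z + g + l) / 2)) ≠ 0 ∧
    (∏ l ∈ range N, Real.sin (α * (z + 1 - g + l) / 2)) ≠ 0 ∧
    0 < ((-1 : ℝ) ^ signExp n p L * (-1) ^ signExp n p (n - L)) ^ N *
      (Real.sin (α * (z + N) / 2) / Real.sin (α * z / 2) *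
        ((∏ l ∈ range N, Real.sin (α * (z + g + l) / 2)) /
          ∏ l ∈ range N, Real.sin (α * (z + 1 - g + l) / 2))) := by
  have hl : ∀ l < N, (l : ℝ) + 1 ≤ M := fun l h => by
    have : ((l + 1 : ℕ) : ℝ) ≤ N := by exact_mod_cast h
    push_cast at this
    linarith
  subst hz
  obtain ⟨b1, b2⟩ := root_value_bounds (x := 0) hq.le hpq hM hqM hL1 hLn hd le_rfl hM.le
  obtain ⟨b3, b4⟩ := root_value_bounds hq.le hpq hM hqM hL1 hLn hd (Nat.cast_nonneg N) hN
  rw [add_zero] at b1 b2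
  have s0 := neg_one_zpow_mul_sin_pos hα _ b1 b2
  have s1 := neg_one_zpow_mul_sin_pos hα _ b3 b4
  obtain ⟨u0, u1⟩ := prod_ne_zero_and_sign fun l h =>
    sign_upper_pochhammer hα hq hpq hM hqM hg hL1 hLn hd (Nat.cast_nonneg l) (hl l h)
  obtain ⟨w0, w1⟩ := prod_ne_zero_and_sign fun l h =>
    sign_lower_pochhammer hα hq hpq hM hqM hg hL1 hLn hd (Nat.cast_nonneg l) (hl l h)
  refine ⟨fun h => by rw [h] at s0; simp at s0, u0, w0, ?_⟩
  have hs : (-1 : ℝ) ^ signExp n p L * (-1) ^ signExp n p (n - L) =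
      (-1) ^ ((d + p - 1) / n) * ((-1) ^ ((d - p) / n))⁻¹ := by
    have e := floor_add_floor_eq_signExp hp1 hpn hq.le hpq hL1 hLn hd
    have h1 : (-1 : ℝ) ≠ 0 := by norm_num
    rw [← zpow_neg, ← zpow_add₀ h1, ← zpow_add₀ h1,
      show (d + p - 1) / n + -((d - p) / n) =
        signExp n p L + signExp n p (n - L) +
          2 * (d / n - signExp n p (n - L) - (d - p) / n) by linear_combination e,
      zpow_add₀ h1, zpow_add₀ h1, zpow_add₀ h1, zpow_mul]
    simp
  rw [hs]
  have := mul_pos (div_pos s1 s0) (div_pos u1 w1)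
  rw [mul_div_mul_left _ _ (zpow_ne_zero _ (by norm_num))] at this
  refine this.trans_eq ?_
  rw [mul_pow, inv_pow, div_eq_mul_inv (_ * _) (_ * _), mul_inv]
  ring

lemma poch_natCast (α z : ℝ) (N : ℕ) :
    poch α z N = ∏ l ∈ range N, Real.sin (α * (z + l) / 2) := by
  simp [poch]

lemma poch_neg_natCast (α z : ℝ) (N : ℕ) :
    poch α z (-(N : ℤ)) = 1 / ∏ l ∈ range N, Real.sin (α * (z - (l + 1)) / 2) := by
  rcases Nat.eq_zero_or_pos N with rfl | hN
  · simp [poch]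
  · rw [poch, if_neg (by omega), neg_neg, Int.toNat_natCast,
      ← Finset.Ico_add_one_right_eq_Icc, Finset.prod_Ico_eq_prod_range]
    simp [add_comm]

/-- The sign of the contribution of a positive root of height `L` to `Delta` is `(ε L * ε (n-L))^N`
for some sign function `ε`. -/
lemma exists_root_factor_sign {n p q : ℤ} {α g M : ℝ} (hα : 0 < α)
    (hp1 : 1 ≤ p) (hpn : p < n) (hq1 : 1 ≤ q) (hqn : q < n) (hpq : n ∣ p * q - 1)
    (hg : n * g = 2 * π / α * p - M)
    (hM : (0 < M ∧ q * M < 2 * π / α) ∨ (M < 0 ∧ (n - q) * (-M) < 2 * π / α)) :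
    ∃ ε : ℤ → ℝ, (∀ L, ε L * ε L = 1) ∧
      ∀ (L d : ℤ) (N : ℕ) (z : ℝ), 1 ≤ L → L < n → n ∣ d - L * p → (N : ℝ) ≤ |M| →
        z = (2 * π / α * d - L * M) / n →
        Real.sin (α * z / 2) ≠ 0 ∧
        poch α (z + Real.sign M * g) ⌊Real.sign M * N⌋ ≠ 0 ∧
        poch α (z + 1 - Real.sign M * g) ⌊Real.sign M * N⌋ ≠ 0 ∧
        0 < (ε L * ε (n - L)) ^ N *
          (Real.sin (α * (z + Real.sign M * N) / 2) / Real.sin (α * z / 2) *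
            (poch α (z + Real.sign M * g) ⌊Real.sign M * N⌋ /
              poch α (z + 1 - Real.sign M * g) ⌊Real.sign M * N⌋)) := by
  have hn : 0 < n := by omega
  have hnR : (0 : ℝ) < n := by exact_mod_cast hn
  rcases hM with ⟨hM, hqM⟩ | ⟨hM, hqM⟩
  · refine ⟨fun L => (-1) ^ signExp n p L, fun L => neg_one_zpow_mul_neg_one_zpow _, ?_⟩
    intro L d N z hL1 hLn hd hN hz
    rw [abs_of_pos hM] at hN
    rw [Real.sign_of_pos hM, one_mul, one_mul, Int.floor_natCast, poch_natCast, poch_natCast]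
    exact root_factor_sign hα hp1 hpn (by omega) hpq hM hqM hg hL1 hLn hd hN hz
  · refine ⟨fun L => (-1) ^ signExp n (n - p) L, fun L => neg_one_zpow_mul_neg_one_zpow _, ?_⟩
    intro L d N z hL1 hLn hd hN hz
    rw [abs_of_neg hM] at hN
    have hpq' : n ∣ (n - p) * (n - q) - 1 := by
      have : (n - p) * (n - q) - 1 = n * (n - p - q) + (p * q - 1) := by ring
      rw [this]
      exact dvd_add (dvd_mul_right _ _) hpq
    have hd' : n ∣ -d - L * (n - p) := by
      have : -d - L * (n - p) = n * (-L) - (d - L * p) := by ring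
      rw [this]
      exact dvd_sub (dvd_mul_right _ _) hd
    obtain ⟨r0, r1, r2, r3⟩ := root_factor_sign (q := n - q) (g := 2 * π / α - g) (M := -M)
      (z := -z) hα (by omega : 1 ≤ n - p) (by omega) (by omega) hpq' (by linarith)
      (by push_cast; exact hqM) (by push_cast; linear_combination -hg) hL1 hLn hd' hN
      (by rw [hz]; push_cast; ring)
    have t0 : Real.sin (α * -z / 2) = -Real.sin (α * z / 2) := by
      rw [← Real.sin_neg]; congr 1; ring
    have t1 : Real.sin (α * (-z + N) / 2) = -Real.sin (α * (z + -1 * N) / 2) := by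
      rw [← Real.sin_neg]; congr 1; ring
    have t2 : ∀ l : ℕ, Real.sin (α * (-z + (2 * π / α - g) + l) / 2) =
        Real.sin (α * (z + 1 - -1 * g - (l + 1)) / 2) := by
      intro l
      rw [← Real.sin_pi_sub]; congr 1; field_simp; ring
    have t3 : ∀ l : ℕ, Real.sin (α * (-z + 1 - (2 * π / α - g) + l) / 2) =
        Real.sin (α * (z + -1 * g - (l + 1)) / 2) := by
      intro l
      rw [← Real.sin_pi_sub, ← Real.sin_sub_two_pi]; congr 1; field_simp; ring
    simp only [t0, t1, t2, t3] at r0 r1 r2 r3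
    have hfl : ⌊(-1 : ℝ) * N⌋ = -(N : ℤ) := by
      rw [show (-1 : ℝ) * N = ((-(N : ℤ) : ℤ) : ℝ) by push_cast; ring, Int.floor_intCast]
    rw [Real.sign_of_neg hM, hfl, poch_neg_natCast, poch_neg_natCast]
    refine ⟨neg_ne_zero.1 r0, one_div_ne_zero r2, one_div_ne_zero r1, ?_⟩
    rw [neg_div_neg_eq] at r3
    rwa [one_div, one_div, inv_div_inv]

/-- Signs depending only on the height of a root cancel in the product over all positive roots. -/
lemma prod_height_signs_eq_one {n : ℕ} {ε : ℤ → ℝ} (hε : ∀ L, ε L * ε L = 1)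
    (N : ℕ → ℕ → ℕ) (P : ℕ → ℕ) (hN : ∀ a b, 1 ≤ a → a ≤ b → P b = P a + N a b) :
    ∏ a ∈ Icc 1 n, ∏ b ∈ Icc 1 n,
      (if a < b then (ε ((b : ℤ) - a) * ε (n - ((b : ℤ) - a))) ^ N a b else 1) = 1 := by
  set ψ : ℤ → ℝ := fun L => ε L * ε (n - L) with hψ
  have hψ2 : ∀ L, ψ L * ψ L = 1 := fun L => by
    linear_combination (ε (n - L) * ε (n - L)) * hε L + hε (n - L)
  have hψs : ∀ L, ψ (n - L) = ψ L := fun L => by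
    simp only [hψ, sub_sub_cancel, mul_comm]
  have h1 : ∀ a ∈ Icc 1 n, ∀ b ∈ Icc 1 n, (if a < b then ψ ((b : ℤ) - a) ^ N a b else 1) =
      (if a < b then ψ ((b : ℤ) - a) else 1) ^ P b *
        (if a < b then ψ ((b : ℤ) - a) else 1) ^ P a := by
    intro a ha b hb
    split_ifs with h
    · rw [← pow_add, hN a b (mem_Icc.1 ha).1 h.le,
        show P a + N a b + P a = 2 * P a + N a b by ring, pow_add, pow_mul, pow_two, hψ2]
      simp
    · simp
  rw [show (∏ a ∈ Icc 1 n, ∏ b ∈ Icc 1 n,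
      (if a < b then (ε ((b : ℤ) - a) * ε (n - ((b : ℤ) - a))) ^ N a b else 1)) = _ from
    prod_congr rfl fun a ha => prod_congr rfl fun b hb => h1 a ha b hb]
  simp only [prod_mul_distrib]
  rw [prod_comm, ← prod_mul_distrib]
  refine prod_eq_one fun c hc => ?_
  obtain ⟨hc1, hcn⟩ := mem_Icc.1 hc
  rw [prod_pow, prod_pow, ← mul_pow]
  suffices h : (∏ a ∈ Icc 1 n, if a < c then ψ ((c : ℤ) - a) else 1) *
      (∏ b ∈ Icc 1 n, if c < b then ψ ((b : ℤ) - c) else 1) = 1 by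
    rw [h, one_pow]
  have l1 : (∏ a ∈ Icc 1 n, if a < c then ψ ((c : ℤ) - a) else 1) = ∏ L ∈ Ico 1 c, ψ L := by
    rw [← prod_filter]
    refine prod_nbij' (fun a => c - a) (fun a => c - a) ?_ ?_ ?_ ?_ ?_
    · intro a; simp; omega
    · intro a; simp; omega
    · intro a; simp; omega
    · intro a; simp; omega
    · intro a ha
      simp only [mem_filter, mem_Icc] at ha
      rw [Nat.cast_sub ha.2.le]
  have l2 : (∏ b ∈ Icc 1 n, if c < b then ψ ((b : ℤ) - c) else 1) = ∏ L ∈ Ico c n, ψ L := by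
    rw [← prod_filter]
    refine prod_nbij' (fun a => n + c - a) (fun a => n + c - a) ?_ ?_ ?_ ?_ ?_
    · intro a; simp; omega
    · intro a; simp; omega
    · intro a; simp; omega
    · intro a; simp; omega
    · intro a ha
      simp only [mem_filter, mem_Icc] at ha
      rw [← hψs, Nat.cast_sub (by omega)]
      congr 1; push_cast; ring
  have l3 : ∏ L ∈ Ico 1 n, ε (n - (L : ℤ)) = ∏ L ∈ Ico 1 n, ε (L : ℤ) := by
    refine prod_nbij' (fun a => n - a) (fun a => n - a) ?_ ?_ ?_ ?_ ?_
    · intro a; simp; omega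
    · intro a; simp; omega
    · intro a; simp; omega
    · intro a; simp; omega
    · intro a ha
      rw [Nat.cast_sub (mem_Ico.1 ha).2.le]
  rw [l1, l2, prod_Ico_consecutive _ hc1 hcn]
  simp only [hψ]
  rw [prod_mul_distrib, l3, ← prod_mul_distrib]
  exact prod_eq_one fun L _ => hε L

/-- The vertex at position `t` of the path `p, 2p, …, np ≡ n` formed by the simple roots `aa n p j`. -/
def pathVertex (n p t : ℕ) : ℕ := (t * p + (n - 1)) % n + 1

lemma pathVertex_mem {n : ℕ} (hn : 0 < n) (p t : ℕ) : pathVertex n p t ∈ Icc 1 n := by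
  have := Nat.mod_lt (t * p + (n - 1)) hn
  simp only [pathVertex, mem_Icc]
  omega

lemma pathVertex_modEq {n : ℕ} (hn : 0 < n) (p t : ℕ) : pathVertex n p t ≡ t * p [MOD n] := by
  have h : pathVertex n p t ≡ t * p + (n - 1) + 1 [MOD n] := (Nat.mod_modEq _ _).add_right 1
  refine h.trans ?_
  rw [show t * p + (n - 1) + 1 = t * p + n by omega]
  simp [Nat.ModEq]

lemma eq_of_modEq_of_mem_Icc {n x y : ℕ} (hx : x ∈ Icc 1 n) (hy : y ∈ Icc 1 n)
    (h : x ≡ y [MOD n]) : x = y := by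
  rw [mem_Icc] at hx hy
  obtain ⟨c, hc⟩ := (Nat.modEq_iff_dvd.1 h)
  have h1 : c < 1 := by
    by_contra! hc'
    nlinarith
  have h2 : -1 < c := by
    by_contra! hc'
    nlinarith
  have : c = 0 := by omega
  rw [this] at hc
  omega

lemma pathVertex_injOn {n p : ℕ} (hn : 0 < n) (hcop : Nat.Coprime p n) :
    Set.InjOn (pathVertex n p) (Icc 1 n : Finset ℕ) := by
  intro s hs t ht h
  refine eq_of_modEq_of_mem_Icc hs ht ?_
  refine Nat.ModEq.cancel_right_of_coprime (c := p) hcop.symm ?_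
  exact (pathVertex_modEq hn p s).symm.trans (h ▸ pathVertex_modEq hn p t)

lemma pathVertex_self {n : ℕ} (hn : 0 < n) (p : ℕ) : pathVertex n p n = n :=
  eq_of_modEq_of_mem_Icc (pathVertex_mem hn p n) (mem_Icc.2 ⟨hn, le_rfl⟩)
    ((pathVertex_modEq hn p n).trans (by simp [Nat.ModEq]))

lemma image_pathVertex {n p : ℕ} (hn : 0 < n) (hcop : Nat.Coprime p n) :
    (Icc 1 n).image (pathVertex n p) = Icc 1 n :=
  eq_of_subset_of_card_le (image_subset_iff.2 fun t _ => pathVertex_mem hn p t)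
    (card_image_of_injOn (pathVertex_injOn hn hcop)).ge

lemma pathVertex_mem_of_lt {n p t : ℕ} (hcop : Nat.Coprime p n) (ht : t ∈ Ico 1 n) :
    pathVertex n p t ∈ Icc 1 (n - 1) := by
  rw [mem_Ico] at ht
  have hn : 0 < n := by omega
  have h1 := mem_Icc.1 (pathVertex_mem hn p t)
  have h2 : pathVertex n p t ≠ n := fun h => by
    have := pathVertex_injOn hn hcop (mem_coe.2 (mem_Icc.2 ⟨ht.1, ht.2.le⟩))
      (mem_coe.2 (mem_Icc.2 ⟨hn, le_rfl⟩)) (h.trans (pathVertex_self hn p).symm)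
    omega
  rw [mem_Icc]
  omega

lemma pathVertex_succ {n p t : ℕ} (hp : p < n) :
    (pathVertex n p (t + 1) : ℤ) =
      pathVertex n p t + p - n * if n - p < pathVertex n p t then 1 else 0 := by
  have hn : 0 < n := by omega
  have h0 := mem_Icc.1 (pathVertex_mem hn p t)
  have hmod : pathVertex n p (t + 1) ≡ pathVertex n p t + p [MOD n] := by
    refine (pathVertex_modEq hn p (t + 1)).trans ?_
    rw [add_mul, one_mul]
    exact ((pathVertex_modEq hn p t).add_right p).symm
  split_ifs with h
  · have : pathVertex n p (t + 1) = pathVertex n p t + p - n := by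
      refine eq_of_modEq_of_mem_Icc (pathVertex_mem hn p _) (mem_Icc.2 (by omega)) (hmod.trans ?_)
      conv_lhs => rw [show pathVertex n p t + p = pathVertex n p t + p - n + n by omega]
      simp [Nat.ModEq]
    omega
  · have : pathVertex n p (t + 1) = pathVertex n p t + p :=
      eq_of_modEq_of_mem_Icc (pathVertex_mem hn p _) (mem_Icc.2 (by omega)) hmod
    omega

lemma ee_congr {n i j : ℕ} (h : i ≡ j [MOD n]) : ee n i = ee n j := by
  unfold ee
  rw [show i % n = j % n from h]

lemma aa_pathVertex {n : ℕ} (hn : 0 < n) (p t : ℕ) :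
    aa n p (pathVertex n p t) = ee n (pathVertex n p t) - ee n (pathVertex n p (t + 1)) := by
  unfold aa
  congr 1
  refine ee_congr ?_
  refine ((pathVertex_modEq hn p t).add_right p).trans ?_
  rw [show t * p + p = (t + 1) * p by ring]
  exact (pathVertex_modEq hn p (t + 1)).symm

lemma ee_sub_ee_eq_sum {n a b : ℕ} (hn : 0 < n) (p : ℕ) (hab : a ≤ b) :
    ee n (pathVertex n p a) - ee n (pathVertex n p b) =
      ∑ t ∈ Ico a b, aa n p (pathVertex n p t) := by
  simp only [aa_pathVertex hn]
  rw [← neg_sub, ← sum_Ico_sub (fun t => ee n (pathVertex n p t)) hab, ← sum_neg_distrib]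
  simp only [neg_sub]

lemma inn_sum_left {n : ℕ} {ι : Type*} (s : Finset ι) (f : ι → Fin n → ℝ) (y : Fin n → ℝ) :
    inn (∑ i ∈ s, f i) y = ∑ i ∈ s, inn (f i) y := by
  simp only [inn, Finset.sum_apply, sum_mul]
  exact sum_comm

lemma inn_sum_right {n : ℕ} {ι : Type*} (s : Finset ι) (x : Fin n → ℝ) (f : ι → Fin n → ℝ) :
    inn x (∑ i ∈ s, f i) = ∑ i ∈ s, inn x (f i) := by
  simp only [inn, Finset.sum_apply, mul_sum]
  exact sum_comm

lemma inn_smul_left {n : ℕ} (c : ℝ) (x y : Fin n → ℝ) : inn (c • x) y = c * inn x y := by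
  simp only [inn, Pi.smul_apply, smul_eq_mul, mul_sum, mul_assoc]

lemma inn_smul_right {n : ℕ} (c : ℝ) (x y : Fin n → ℝ) : inn x (c • y) = c * inn x y := by
  simp only [inn, Pi.smul_apply, smul_eq_mul, mul_sum]
  exact sum_congr rfl fun i _ => by ring

lemma inn_add_right {n : ℕ} (x y z : Fin n → ℝ) : inn x (y + z) = inn x y + inn x z := by
  simp only [inn, Pi.add_apply, mul_add, sum_add_distrib]

lemma inn_neg_left {n : ℕ} (x y : Fin n → ℝ) : inn (-x) y = -inn x y := by
  simp only [inn, Pi.neg_apply, neg_mul, sum_neg_distrib]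

lemma ee_injOn {n : ℕ} : Set.InjOn (ee n) (Icc 1 n : Finset ℕ) := by
  intro j hj k hk h
  have hj' := mem_Icc.1 (mem_coe.1 hj)
  have := congrFun h ⟨j - 1, by omega⟩
  simp only [ee] at this
  rw [show j - 1 + 1 = j by omega, if_pos rfl] at this
  refine eq_of_modEq_of_mem_Icc hj hk ?_
  by_contra hne
  rw [if_neg (show ¬j % n = k % n from hne)] at this
  exact one_ne_zero this

/-- The positive roots are the differences of vertices in increasing order along the path. -/
lemma inPosRoots_pathVertex_iff {n p a b : ℕ} (hcop : Nat.Coprime p n)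
    {ω : ℕ → Fin n → ℝ}
    (hωδ : ∀ j : ℕ, 1 ≤ j → j ≤ n - 1 → ∀ k : ℕ, 1 ≤ k → k ≤ n - 1 →
      inn (aa n p j) (ω k) = if j = k then (1 : ℝ) else 0)
    (ha : a ∈ Icc 1 n) (hb : b ∈ Icc 1 n) :
    inPosRoots n p (ee n (pathVertex n p a) - ee n (pathVertex n p b)) ↔ a < b := by
  have ha' := mem_Icc.1 ha
  have hb' := mem_Icc.1 hb
  have hn : 0 < n := by omega
  constructor
  · rintro ⟨⟨j, hj, k, hk, hjk, hv⟩, c, hc⟩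
    by_contra! hba
    have hne : b ≠ a := by
      rintro rfl
      rw [sub_self] at hv
      exact hjk (ee_injOn hj hk (sub_eq_zero.1 hv.symm))
    have hh : ∀ i ∈ Icc 1 (n - 1), inn (aa n p i) (∑ k ∈ Icc 1 (n - 1), ω k) = 1 := by
      intro i hi
      have hi' := mem_Icc.1 hi
      rw [inn_sum_right, sum_congr rfl fun k hk =>
        hωδ i hi'.1 hi'.2 k (mem_Icc.1 hk).1 (mem_Icc.1 hk).2, sum_ite_eq, if_pos hi]
    have e1 := congrArg (fun x => inn x (∑ k ∈ Icc 1 (n - 1), ω k)) hc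
    rw [← neg_sub, ee_sub_ee_eq_sum hn p hba, inn_neg_left, inn_sum_left, inn_sum_left,
      sum_congr rfl fun t ht => hh _ (pathVertex_mem_of_lt hcop (by
        rw [mem_Ico] at ht ⊢; omega)), sum_const, Nat.card_Ico, nsmul_eq_mul, mul_one,
      sum_congr rfl fun i hi => by rw [inn_smul_left, hh i hi, mul_one]] at e1
    have h1 : (0 : ℝ) ≤ ∑ i ∈ Icc 1 (n - 1), (c i : ℝ) := sum_nonneg fun _ _ => Nat.cast_nonneg _
    have h2 : (0 : ℝ) < ((a - b : ℕ) : ℝ) := by exact_mod_cast (by omega : 0 < a - b)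
    linarith
  · intro hab
    refine ⟨⟨_, pathVertex_mem hn p a, _, pathVertex_mem hn p b, fun h => ?_, rfl⟩, ?_⟩
    · exact hab.ne (pathVertex_injOn hn hcop ha hb h)
    · refine ⟨fun i => #{t ∈ Ico a b | pathVertex n p t = i}, ?_⟩
      rw [ee_sub_ee_eq_sum hn p hab.le, ← sum_fiberwise_of_maps_to (t := Icc 1 (n - 1))
        (g := pathVertex n p) fun t ht => pathVertex_mem_of_lt hcop (by
          rw [mem_Ico] at ht ⊢; omega)]
      refine sum_congr rfl fun i _ => ?_
      rw [sum_congr rfl fun t ht => by rw [(mem_filter.1 ht).2], sum_const, Nat.cast_smul_eq_nsmul]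

lemma inn_aa_rhoP {n p j : ℕ} {α g : ℝ} (hp1 : 1 ≤ p) {ω : ℕ → Fin n → ℝ}
    (hωδ : ∀ j : ℕ, 1 ≤ j → j ≤ n - 1 → ∀ k : ℕ, 1 ≤ k → k ≤ n - 1 →
      inn (aa n p j) (ω k) = if j = k then (1 : ℝ) else 0)
    (hj : j ∈ Icc 1 (n - 1)) :
    inn (aa n p j) (rhoP n p α g ω) = g - 2 * π / α * if n - p < j then 1 else 0 := by
  have hj' := mem_Icc.1 hj
  rw [rhoP, inn_add_right, inn_smul_right, inn_smul_right, inn_sum_right, inn_sum_right,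
    sum_congr rfl fun k hk => hωδ j hj'.1 hj'.2 k (mem_Icc.1 hk).1
      ((mem_Icc.1 hk).2.trans (by omega)),
    sum_congr rfl fun k hk => hωδ j hj'.1 hj'.2 k (le_trans (by omega) (mem_Icc.1 hk).1)
      (mem_Icc.1 hk).2, sum_ite_eq, sum_ite_eq]
  simp only [mem_Icc]
  split_ifs <;> first | omega | ring

lemma inn_root_rhoP {n p a b : ℕ} {α g : ℝ} (hp1 : 1 ≤ p) (hpn : p < n)
    (hcop : Nat.Coprime p n) {ω : ℕ → Fin n → ℝ}
    (hωδ : ∀ j : ℕ, 1 ≤ j → j ≤ n - 1 → ∀ k : ℕ, 1 ≤ k → k ≤ n - 1 →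
      inn (aa n p j) (ω k) = if j = k then (1 : ℝ) else 0)
    (ha : 1 ≤ a) (hab : a ≤ b) (hb : b ≤ n) :
    inn (ee n (pathVertex n p a) - ee n (pathVertex n p b)) (rhoP n p α g ω) =
      (2 * π / α * ((pathVertex n p b : ℝ) - pathVertex n p a) -
        ((b : ℝ) - a) * (2 * π * p / α - n * g)) / n := by
  have hn : 0 < n := by omega
  have hnR : (n : ℝ) ≠ 0 := by exact_mod_cast hn.ne'
  rw [ee_sub_ee_eq_sum hn p hab, inn_sum_left]
  let f : ℕ → ℝ := fun t => (2 * π / α * pathVertex n p t - t * (2 * π * p / α - n * g)) / n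
  have hf : ∀ t ∈ Ico a b, inn (aa n p (pathVertex n p t)) (rhoP n p α g ω) = f (t + 1) - f t := by
    intro t ht
    rw [inn_aa_rhoP hp1 hωδ (pathVertex_mem_of_lt hcop (by rw [mem_Ico] at ht ⊢; omega))]
    have h := pathVertex_succ (t := t) hpn
    have h' : (pathVertex n p (t + 1) : ℝ) = pathVertex n p t + p -
        n * if n - p < pathVertex n p t then 1 else 0 := by
      have := congrArg (Int.cast : ℤ → ℝ) h
      push_cast at this
      exact this
    simp only [f, h']
    push_cast
    field_simp
    ring
  rw [sum_congr rfl hf, sum_Ico_sub f hab]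
  simp only [f]
  ring

lemma inn_aa_weight {n p j : ℕ} {m : ℕ → ℕ} {ω : ℕ → Fin n → ℝ}
    (hωδ : ∀ j : ℕ, 1 ≤ j → j ≤ n - 1 → ∀ k : ℕ, 1 ≤ k → k ≤ n - 1 →
      inn (aa n p j) (ω k) = if j = k then (1 : ℝ) else 0)
    (hj : j ∈ Icc 1 (n - 1)) :
    inn (aa n p j) (∑ k ∈ Icc 1 (n - 1), (m k : ℝ) • ω k) = m j := by
  have hj' := mem_Icc.1 hj
  rw [inn_sum_right, sum_congr rfl fun k hk => by
    rw [inn_smul_right, hωδ j hj'.1 hj'.2 k (mem_Icc.1 hk).1 (mem_Icc.1 hk).2, mul_ite, mul_one,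
      mul_zero], sum_ite_eq, if_pos hj]

lemma prod_Icc_pathVertex {n p : ℕ} (hn : 0 < n) (hcop : Nat.Coprime p n) (f : ℕ → ℝ) :
    ∏ j ∈ Icc 1 n, f j = ∏ a ∈ Icc 1 n, f (pathVertex n p a) := by
  conv_lhs => rw [← image_pathVertex hn hcop]
  exact prod_image (pathVertex_injOn hn hcop)

lemma inn_root_weight {n p a b : ℕ} (hn : 0 < n) (hcop : Nat.Coprime p n) {m : ℕ → ℕ}
    {ω : ℕ → Fin n → ℝ}
    (hωδ : ∀ j : ℕ, 1 ≤ j → j ≤ n - 1 → ∀ k : ℕ, 1 ≤ k → k ≤ n - 1 →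
      inn (aa n p j) (ω k) = if j = k then (1 : ℝ) else 0)
    (ha : 1 ≤ a) (hab : a ≤ b) (hb : b ≤ n) :
    inn (ee n (pathVertex n p a) - ee n (pathVertex n p b))
        (∑ k ∈ Icc 1 (n - 1), (m k : ℝ) • ω k) =
      ((∑ t ∈ Ico a b, m (pathVertex n p t) : ℕ) : ℝ) := by
  rw [ee_sub_ee_eq_sum hn p hab, inn_sum_left, Nat.cast_sum]
  exact sum_congr rfl fun t ht => inn_aa_weight hωδ
    (pathVertex_mem_of_lt hcop (by rw [mem_Ico] at ht ⊢; omega))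

lemma sum_weight_le {n p a b : ℕ} (hcop : Nat.Coprime p n) (m : ℕ → ℕ)
    (ha : 1 ≤ a) (hb : b ≤ n) :
    ∑ t ∈ Ico a b, m (pathVertex n p t) ≤ ∑ j ∈ Icc 1 (n - 1), m j := by
  rcases Nat.eq_zero_or_pos n with rfl | hn
  · simp [Ico_eq_empty_of_le (show b ≤ a by omega)]
  have hinj : Set.InjOn (pathVertex n p) (Ico a b : Finset ℕ) :=
    (pathVertex_injOn hn hcop).mono fun t ht => by
      simp only [coe_Ico, coe_Icc, Set.mem_Ico, Set.mem_Icc] at ht ⊢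
      omega
  rw [← sum_image hinj]
  refine sum_le_sum_of_subset (image_subset_iff.2 fun t ht => pathVertex_mem_of_lt hcop ?_)
  rw [mem_Ico] at ht ⊢
  omega

/-- The bounds on `M = 2πp/α - ng` defining the type (i) couplings. -/
lemma TypeI.bounds {n p q : ℕ} {α g : ℝ} (hn : 2 ≤ n) (h : TypeI n p q α g) :
    (0 < 2 * π * p / α - n * g ∧ q * (2 * π * p / α - n * g) < 2 * π / α) ∨
      (2 * π * p / α - n * g < 0 ∧ (n - q) * (-(2 * π * p / α - n * g)) < 2 * π / α) := by
  obtain ⟨hq1, hqn, -, h⟩ := h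
  have hnR : (0 : ℝ) < n := by exact_mod_cast (by omega : 0 < n)
  have hqR : (0 : ℝ) < q := by exact_mod_cast (by omega : 0 < q)
  have hnq : (0 : ℝ) < n - q := sub_pos.2 (by exact_mod_cast (by omega : q < n))
  have hR : 2 * π * p / α = 2 * π / α * p := by ring
  rw [hR]
  set R := 2 * π / α
  rcases h with ⟨h1, h2⟩ | ⟨h1, h2⟩
  · left
    have h1' := mul_lt_mul_of_pos_left h1 (mul_pos hqR hnR)
    have h2' := mul_lt_mul_of_pos_left h2 hnR
    have e1 : q * n * (R * (p / n - 1 / (n * q))) = q * (R * p) - R := by field_simp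
    have e2 : n * (R * (p / n)) = R * p := by field_simp
    constructor <;> linarith
  · right
    have h1' := mul_lt_mul_of_pos_left h1 hnR
    have h2' := mul_lt_mul_of_pos_left h2 (mul_pos hnq hnR)
    have e1 : (n - q) * n * (R * (p / n + 1 / (n * (n - q)))) = (n - q) * (R * p) + R := by
      field_simp
    have e2 : n * (R * (p / n)) = R * p := by field_simp
    constructor <;> linarith

/-- Corollary 3.2: for every `μ ∈ Λ⁺_{p,|M|}`, all sine denominators
occurring in `Δ_p(μ)` are nonzero and `Δ_p(μ) > 0`. -/
theorem statement14 (n p q : ℕ) (α g : ℝ)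
    (hn : 2 ≤ n) (hα : 0 < α) (hp1 : 1 ≤ p) (hpn : p ≤ n - 1) (hcop : Nat.Coprime p n)
    (htype : TypeI n p q α g)
    (Mz : ℤ) (hMz : 2 * π * p / α - n * g = (Mz : ℝ)) (hMz0 : Mz ≠ 0)
    (ω : ℕ → Fin n → ℝ)
    (hωE : ∀ k : ℕ, 1 ≤ k → k ≤ n - 1 → ∑ i, ω k i = 0)
    (hωδ : ∀ j : ℕ, 1 ≤ j → j ≤ n - 1 → ∀ k : ℕ, 1 ≤ k → k ≤ n - 1 →
      inn (aa n p j) (ω k) = if j = k then (1 : ℝ) else 0)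
    (μ : Fin n → ℝ) (hμ : μ ∈ Lam n |2 * π * p / α - n * g| ω) :
    (∀ j ∈ Icc 1 n, ∀ k ∈ Icc 1 n, inPosRoots n p (ee n j - ee n k) →
      Real.sin (α * inn (ee n j - ee n k) (rhoP n p α g ω) / 2) ≠ 0 ∧
      poch α (inn (ee n j - ee n k) (rhoP n p α g ω) +
          Real.sign (2 * π * p / α - n * g) * g)
        ⌊Real.sign (2 * π * p / α - n * g) * inn (ee n j - ee n k) μ⌋ ≠ 0 ∧
      poch α (inn (ee n j - ee n k) (rhoP n p α g ω) + 1 -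
          Real.sign (2 * π * p / α - n * g) * g)
        ⌊Real.sign (2 * π * p / α - n * g) * inn (ee n j - ee n k) μ⌋ ≠ 0) ∧
    0 < Delta n p α g ω μ := by
  have hn0 : 0 < n := by omega
  have hpn' : p < n := by omega
  obtain ⟨m, hm, rfl⟩ := hμ
  have hMb := htype.bounds hn
  obtain ⟨hq1, hqn, hpq, -⟩ := htype
  have hpq' : (n : ℤ) ∣ p * q - 1 := by
    have := (Nat.modEq_iff_dvd.1 (show 1 ≡ p * q [MOD n] from hpq.symm))
    exact_mod_cast this
  obtain ⟨ε, hε, H⟩ := exists_root_factor_sign (n := n) (p := p) (q := q) (g := g)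
    (M := 2 * π * p / α - n * g) hα (by exact_mod_cast hp1) (by exact_mod_cast hpn')
    (by exact_mod_cast hq1) (by omega) hpq' (by push_cast; ring) (by exact_mod_cast hMb)
  set s := Real.sign (2 * π * p / α - n * g)
  set μ := ∑ j ∈ Icc 1 (n - 1), (m j : ℝ) • ω j with hμ
  let N : ℕ → ℕ → ℕ := fun a b => ∑ t ∈ Ico a b, m (pathVertex n p t)
  have hroot : ∀ a ∈ Icc 1 n, ∀ b ∈ Icc 1 n, a < b →
      inn (ee n (pathVertex n p a) - ee n (pathVertex n p b)) μ = N a b := fun a ha b hb hab =>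
    inn_root_weight hn0 hcop hωδ (mem_Icc.1 ha).1 hab.le (mem_Icc.1 hb).2
  have key : ∀ a ∈ Icc 1 n, ∀ b ∈ Icc 1 n, a < b → _ := fun a ha b hb hab =>
    H ((b : ℤ) - a) ((pathVertex n p b : ℤ) - pathVertex n p a) (N a b)
      (inn (ee n (pathVertex n p a) - ee n (pathVertex n p b)) (rhoP n p α g ω))
      (by omega) (by rw [mem_Icc] at ha hb; omega)
      (by
        obtain ⟨c, hc⟩ := Nat.modEq_iff_dvd.1 (pathVertex_modEq hn0 p a)
        obtain ⟨k, hk⟩ := Nat.modEq_iff_dvd.1 (pathVertex_modEq hn0 p b)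
        push_cast at hc hk
        exact ⟨c - k, by linear_combination hc - hk⟩)
      (by
        refine le_trans ?_ hm
        exact_mod_cast sum_weight_le hcop m (mem_Icc.1 ha).1 (mem_Icc.1 hb).2)
      (by
        rw [inn_root_rhoP hp1 hpn' hcop hωδ (mem_Icc.1 ha).1 hab.le (mem_Icc.1 hb).2]
        push_cast
        rfl)
  constructor
  · intro j hj k hk hpos
    rw [← image_pathVertex hn0 hcop, mem_image] at hj hk
    obtain ⟨a, ha, rfl⟩ := hj
    obtain ⟨b, hb, rfl⟩ := hk
    have hab := (inPosRoots_pathVertex_iff hcop hωδ ha hb).1 hpos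
    rw [hroot a ha b hb hab]
    obtain ⟨h0, h1, h2, -⟩ := key a ha b hb hab
    exact ⟨h0, h1, h2⟩
  · have hsign := zero_lt_one.trans_eq (prod_height_signs_eq_one (n := n) hε N
      (fun t => N 1 t) fun a b ha hab => (sum_Ico_consecutive _ ha hab).symm).symm
    rw [Delta, prod_Icc_pathVertex hn0 hcop,
      prod_congr rfl fun a _ => prod_Icc_pathVertex hn0 hcop _]
    refine (mul_pos_iff_of_pos_left hsign).1 ?_
    rw [← prod_mul_distrib]
    refine prod_pos fun a ha => ?_
    rw [← prod_mul_distrib]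
    refine prod_pos fun b hb => ?_
    have hiff := inPosRoots_pathVertex_iff hcop hωδ ha hb
    by_cases hab : a < b
    · rw [if_pos hab, if_pos (hiff.2 hab), inn_add_right, inn_smul_right, hroot a ha b hb hab]
      exact (key a ha b hb hab).2.2.2
    · rw [if_neg hab, if_neg (hiff.not.2 hab)]
      norm_num
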